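/- arXiv:2312.09931 — 2 statements merged into one kernel-verified Lean document; each statement's English description precedes it below -/
import Mathlib

section
/- Let {p_j} be a sequence of monic real polynomials with deg p_j = j, orthogonal on (a,b) with respect to the weight w(x) > 0, let k ∈ {0,1,2}, let c_{2k} be a real polynomial of degree 2k with c_{2k}(x)w(x) > 0 on (a,b), and let {g_{j,k}} be monic real polynomials with deg g_{j,k} = j, orthogonal on (a,b) with respect to c_{2k}(x)w(x). Fix n ≥ 2 and suppose A_n·c_{2k}(x)·g_{n−2,k}(x) = a_{2k−2}(x)·p_n(x) − (x − B_n)·p_{n−1}(x) holds on (a,b) with A_n, B_n real constants and a_{2k−2} a real polynomial of degree 2k−2 (a constant when k = 0). Assume p_n has n simple real zeros x_1 < ⋯ < x_n in (a,b), that g_{n−2,k} has n−2 simple real zeros in (a,b), and that g_{n−2,k} and p_n have at least one common zero. Then: (a) they have exactly one common zero, which equals B_n, and this common zero is neither x_1 nor x_n; (b) the n−2 zeros of g_{n−2,k} interlace with the n−1 zeros of p_n that are not the common zero; (c) x_1 < B_n < x_n, so B_n is an upper bound for the smallest zero and a lower bound for the largest zero of p_n. -/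
open MeasureTheory Polynomial

/-- A functional killing `p i * p j` for `i ≠ j` kills `p n * Q` whenever `deg Q < n`. -/
lemma orthogonal_to_lower_degree (L : ℝ[X] →ₗ[ℝ] ℝ) (p : ℕ → ℝ[X])
    (hpmonic : ∀ j, (p j).Monic) (hpdeg : ∀ j, (p j).natDegree = j)
    (horth : ∀ i j, i ≠ j → L (p i * p j) = 0) (n : ℕ) (Q : ℝ[X]) (hQ : Q.degree < n) :
    L (p n * Q) = 0 := by
  have key : ∀ d : ℕ, d ≤ n → ∀ Q : ℝ[X], Q.degree < d → L (p n * Q) = 0 := by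
    intro d
    induction d with
    | zero =>
      intro _ Q hQ
      have : Q = 0 := by
        rw [← degree_eq_bot, ← Nat.WithBot.lt_zero_iff]
        simpa using hQ
      simp [this]
    | succ d ih =>
      intro hd Q hQ
      have h1 : (Q - C (Q.coeff d) * p d).degree < d := by
        rw [degree_lt_iff_coeff_zero]
        intro m hm
        rw [coeff_sub, coeff_C_mul]
        rcases hm.eq_or_lt with rfl | hlt
        · have := (hpmonic d).coeff_natDegree
          rw [hpdeg] at this
          simp [this]
        · have hq := (degree_lt_iff_coeff_zero Q (d + 1)).1 hQ m hlt
          have hp : (p d).coeff m = 0 := coeff_eq_zero_of_natDegree_lt (by rw [hpdeg]; exact hlt)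
          simp [hq, hp]
      have h2 : p n * Q = p n * (Q - C (Q.coeff d) * p d) + Q.coeff d • (p n * p d) := by
        rw [smul_eq_C_mul]; ring
      rw [h2, map_add, map_smul, ih (by omega) _ h1, horth n d (by omega)]
      simp
  exact key n le_rfl Q hQ

/-- At a simple zero `s` of `p (m + 1) = (X - s) r`, the value of `p m` has the sign of `r`. -/
lemma eval_mul_eval_cofactor_pos (L : ℝ[X] →ₗ[ℝ] ℝ) (hL : ∀ P : ℝ[X], P ≠ 0 → 0 < L (P * P))
    (p : ℕ → ℝ[X]) (hpmonic : ∀ j, (p j).Monic) (hpdeg : ∀ j, (p j).natDegree = j)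
    (horth : ∀ i j, i ≠ j → L (p i * p j) = 0) (m : ℕ) (s : ℝ) (r : ℝ[X])
    (hr : p (m + 1) = (X - C s) * r) (hrs : r.eval s ≠ 0) :
    0 < (p m).eval s * r.eval s := by
  have hrm : r.Monic := (monic_X_sub_C s).of_mul_monic_left (hr ▸ hpmonic (m + 1))
  have hrdeg : r.natDegree = m := by
    have h := hpdeg (m + 1)
    rw [hr, (monic_X_sub_C s).natDegree_mul hrm, natDegree_X_sub_C] at h
    omega
  have hdiff : (r - p m).degree < (m : ℕ) := by
    have hd : r.degree = m := by rw [degree_eq_natDegree hrm.ne_zero, hrdeg]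
    have hd' : (p m).degree = m := by rw [degree_eq_natDegree (hpmonic m).ne_zero, hpdeg]
    rw [← hd]
    exact degree_sub_lt_left (hd.trans hd'.symm) hrm.ne_zero
      (hrm.leadingCoeff.trans (hpmonic m).leadingCoeff.symm)
  have h1 : 0 < L (p m * r) := by
    have h := orthogonal_to_lower_degree L p hpmonic hpdeg horth m _ hdiff
    rw [mul_sub, map_sub, sub_eq_zero] at h
    rw [h]
    exact hL _ (hpmonic m).ne_zero
  have h2 : 0 < L (r * r) := hL _ hrm.ne_zero
  set D : ℝ[X] := C (r.eval s) * p m - C ((p m).eval s) * r with hD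
  have hroot : D.IsRoot s := by simp [hD, IsRoot, mul_comm]
  obtain ⟨Q, hQ⟩ := dvd_iff_isRoot.2 hroot
  have hDdeg : D.natDegree ≤ m := by
    refine (natDegree_sub_le _ _).trans (max_le ?_ ?_)
    · exact (natDegree_C_mul_le _ _).trans (hpdeg m).le
    · exact (natDegree_C_mul_le _ _).trans hrdeg.le
  have hQdeg : Q.degree < (m + 1 : ℕ) := by
    by_cases hQ0 : Q = 0
    · rw [hQ0, degree_zero]; exact WithBot.bot_lt_coe _
    · rw [← natDegree_lt_iff_degree_lt hQ0]
      have : D.natDegree = 1 + Q.natDegree := by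
        rw [hQ, natDegree_mul (X_sub_C_ne_zero s) hQ0, natDegree_X_sub_C]
      omega
  have h3 := orthogonal_to_lower_degree L p hpmonic hpdeg horth (m + 1) Q hQdeg
  have h4 : p (m + 1) * Q = r.eval s • (p m * r) - (p m).eval s • (r * r) := by
    have : p (m + 1) * Q = D * r := by rw [hr, hQ]; ring
    rw [this, hD, smul_eq_C_mul, smul_eq_C_mul]; ring
  rw [h4, map_sub, map_smul, map_smul, smul_eq_mul, smul_eq_mul] at h3
  have h5 : (p m).eval s * r.eval s * L (r * r) = r.eval s ^ 2 * L (p m * r) := by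
    linear_combination (-r.eval s) * h3
  have h6 : 0 < r.eval s ^ 2 * L (p m * r) := by positivity
  rw [← h5] at h6
  exact (pos_iff_pos_of_mul_pos h6).2 h2

/-- A monic polynomial of degree `n` with `n` distinct zeros is the product of its linear factors. -/
lemma Polynomial.Monic.eq_prod_X_sub_C_of_injective {n : ℕ} {P : ℝ[X]} (hP : P.Monic)
    (hdeg : P.natDegree = n) {x : Fin n → ℝ} (hx : Function.Injective x)
    (hz : ∀ i, P.eval (x i) = 0) : P = ∏ i, (X - C (x i)) := by
  have hdvd : ∏ i, (X - C (x i)) ∣ P :=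
    Finset.prod_dvd_of_coprime
      (fun i _ j _ hij => pairwise_coprime_X_sub_C hx hij)
      (fun i _ => dvd_iff_isRoot.2 (hz i))
  refine (eq_of_monic_of_dvd_of_natDegree_le (monic_prod_of_monic _ _ fun i _ => monic_X_sub_C _)
    hP hdvd ?_)
  rw [natDegree_prod_of_monic _ _ fun i _ => monic_X_sub_C _]
  simp [hdeg]

/-- Consecutive zeros of `p (m + 1)` are separated by a sign change of `p m`. -/
lemma eval_consecutive_zeros_mul_neg (L : ℝ[X] →ₗ[ℝ] ℝ)
    (hL : ∀ P : ℝ[X], P ≠ 0 → 0 < L (P * P))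
    (p : ℕ → ℝ[X]) (hpmonic : ∀ j, (p j).Monic) (hpdeg : ∀ j, (p j).natDegree = j)
    (horth : ∀ i j, i ≠ j → L (p i * p j) = 0) (m : ℕ)
    (x : Fin (m + 1) → ℝ) (hx : StrictMono x) (hxz : ∀ i, (p (m + 1)).eval (x i) = 0)
    (i : Fin m) : (p m).eval (x i.castSucc) * (p m).eval (x i.succ) < 0 := by
  have hst : x i.castSucc < x i.succ := hx Fin.castSucc_lt_succ
  set h : ℝ[X] := ∏ j ∈ (Finset.univ.erase i.castSucc).erase i.succ, (X - C (x j)) with hh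
  have hfac : p (m + 1) = (X - C (x i.castSucc)) * ((X - C (x i.succ)) * h) := by
    rw [(hpmonic _).eq_prod_X_sub_C_of_injective (hpdeg _) hx.injective hxz, hh,
      Finset.mul_prod_erase _ (fun j => X - C (x j)), Finset.mul_prod_erase _ (fun j => X - C (x j))]
    · simp
    · simp [Fin.castSucc_lt_succ.ne']
  have hpos : 0 < h.eval (x i.castSucc) * h.eval (x i.succ) := by
    rw [hh, eval_prod, eval_prod, ← Finset.prod_mul_distrib]
    refine Finset.prod_pos fun j hj => ?_
    simp only [Finset.mem_erase, Finset.mem_univ, and_true] at hj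
    simp only [eval_sub, eval_X, eval_C]
    rcases lt_or_gt_of_ne hj.2 with hlt | hgt
    · have := hx hlt
      exact mul_pos (by linarith) (by linarith)
    · have hgt' : i.succ < j := lt_of_le_of_ne (Fin.castSucc_lt_iff_succ_le.1 hgt) hj.1.symm
      have := hx hgt'
      exact mul_pos_of_neg_of_neg (by linarith) (by linarith)
  have hs0 : h.eval (x i.castSucc) ≠ 0 := left_ne_zero_of_mul hpos.ne'
  have ht0 : h.eval (x i.succ) ≠ 0 := right_ne_zero_of_mul hpos.ne'
  have h1 := eval_mul_eval_cofactor_pos L hL p hpmonic hpdeg horth m _ _ hfac (by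
    simp only [eval_mul, eval_sub, eval_X, eval_C]
    exact mul_ne_zero (by linarith) hs0)
  have h2 := eval_mul_eval_cofactor_pos L hL p hpmonic hpdeg horth m (x i.succ)
    ((X - C (x i.castSucc)) * h) (by rw [hfac]; ring) (by
    simp only [eval_mul, eval_sub, eval_X, eval_C]
    exact mul_ne_zero (by linarith) ht0)
  simp only [eval_mul, eval_sub, eval_X, eval_C] at h1 h2
  have h3 := mul_pos h1 h2
  have h4 : 0 < (x i.succ - x i.castSucc) ^ 2 := by
    have : 0 < x i.succ - x i.castSucc := by linarith
    positivity
  by_contra! hcon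
  have := mul_nonneg hcon (mul_pos h4 hpos).le
  nlinarith

/-- Increasing enumerations of `N` zeros of a degree `N` polynomial list all its zeros and agree. -/
lemma strictMono_zeros_unique {N : ℕ} {G : ℝ[X]} (hG0 : G ≠ 0) (hG : G.natDegree = N)
    {y : Fin N → ℝ} (hy : StrictMono y) (hyz : ∀ i, G.eval (y i) = 0) :
    (∀ z, G.eval z = 0 → ∃ i, y i = z) ∧
      ∀ z : Fin N → ℝ, StrictMono z → (∀ i, G.eval (z i) = 0) → z = y := by
  have hmem : ∀ i, y i ∈ G.roots.toFinset := fun i => by simp [hG0, hyz]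
  have hcard : G.roots.toFinset.card = N := by
    apply le_antisymm
    · exact (Multiset.toFinset_card_le _).trans ((card_roots' G).trans hG.le)
    · calc N = (Finset.univ.image y).card := by
            rw [Finset.card_image_of_injective _ hy.injective]; simp
        _ ≤ _ := Finset.card_le_card (by
            intro t ht
            obtain ⟨i, -, rfl⟩ := Finset.mem_image.1 ht
            exact hmem i)
  have hyeq := Finset.orderEmbOfFin_unique hcard hmem hy
  refine ⟨fun z hz => ?_, fun z hzm hz => ?_⟩
  · have : z ∈ Set.range (G.roots.toFinset.orderEmbOfFin hcard) := by
      rw [Finset.range_orderEmbOfFin]; simp [hG0, hz]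
    rw [← hyeq] at this
    exact this
  · rw [hyeq]
    exact Finset.orderEmbOfFin_unique hcard (fun i => by simp [hG0, hz]) hzm

/-- Consecutive points after removing `x m` either surround `x m` or were consecutive before. -/
lemma succAbove_consecutive {N : ℕ} {x : Fin (N + 2) → ℝ} (hx : StrictMono x) (m : Fin (N + 2))
    (j : Fin N) :
    (x (m.succAbove j.castSucc) < x m ∧ x m < x (m.succAbove j.succ)) ∨
      ∃ i : Fin (N + 1), m.succAbove j.castSucc = i.castSucc ∧ m.succAbove j.succ = i.succ ∧
        0 < (x i.castSucc - x m) * (x i.succ - x m) := by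
  rcases lt_trichotomy (j.val + 1) m.val with h | h | h
  · have h1 : m.succAbove j.castSucc = j.castSucc.castSucc :=
      Fin.succAbove_of_castSucc_lt _ _ (by simp [Fin.lt_def]; omega)
    have h2 : m.succAbove j.succ = j.castSucc.succ := by
      rw [Fin.succAbove_of_castSucc_lt _ _ (by simp [Fin.lt_def]; omega)]
      ext; simp
    have h3 : x j.castSucc.castSucc < x m := hx (by simp [Fin.lt_def]; omega)
    have h4 : x j.castSucc.succ < x m := hx (by simp [Fin.lt_def]; omega)
    exact Or.inr ⟨j.castSucc, h1, h2, mul_pos_of_neg_of_neg (by linarith) (by linarith)⟩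
  · refine Or.inl ⟨hx ?_, hx ?_⟩
    · rw [Fin.succAbove_of_castSucc_lt _ _ (by simp [Fin.lt_def]; omega)]
      simp [Fin.lt_def]; omega
    · rw [Fin.succAbove_of_le_castSucc _ _ (by simp [Fin.le_def]; omega)]
      simp [Fin.lt_def]; omega
  · have h1 : m.succAbove j.castSucc = j.succ.castSucc := by
      rw [Fin.succAbove_of_le_castSucc _ _ (by simp [Fin.le_def]; omega)]
      ext; simp
    have h2 : m.succAbove j.succ = j.succ.succ :=
      Fin.succAbove_of_le_castSucc _ _ (by simp [Fin.le_def]; omega)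
    have h3 : x m < x j.succ.castSucc := hx (by simp [Fin.lt_def]; omega)
    have h4 : x m < x j.succ.succ := hx (by simp [Fin.lt_def]; omega)
    exact Or.inr ⟨j.succ, h1, h2, mul_pos (by linarith) (by linarith)⟩

lemma integrableOn_eval_mul {S : Set ℝ} {w : ℝ → ℝ}
    (hmom : ∀ j : ℕ, IntegrableOn (fun x => x ^ j * w x) S) (P : ℝ[X]) :
    IntegrableOn (fun x => P.eval x * w x) S := by
  induction P using Polynomial.induction_on' with
  | add P Q hP hQ =>
    simp only [eval_add, add_mul]
    exact hP.add hQ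
  | monomial n a =>
    simp only [eval_monomial, mul_assoc]
    exact (hmom n).const_mul a

/-- The moment functional `P ↦ ∫ x in S, P x * w x`. -/
noncomputable def momentFunctional (S : Set ℝ) (w : ℝ → ℝ)
    (hmom : ∀ j : ℕ, IntegrableOn (fun x => x ^ j * w x) S) : ℝ[X] →ₗ[ℝ] ℝ where
  toFun P := ∫ x in S, P.eval x * w x
  map_add' P Q := by
    simp only [eval_add, add_mul]
    exact integral_add (integrableOn_eval_mul hmom P) (integrableOn_eval_mul hmom Q)
  map_smul' a P := by
    simp only [eval_smul, smul_eq_mul, mul_assoc, RingHom.id_apply]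
    exact integral_const_mul _ _

lemma momentFunctional_mul_self_pos {S : Set ℝ} (hS : IsOpen S) (hne : S.Nonempty) {w : ℝ → ℝ}
    (hw : ∀ x ∈ S, 0 < w x) (hmom : ∀ j : ℕ, IntegrableOn (fun x => x ^ j * w x) S)
    {P : ℝ[X]} (hP : P ≠ 0) : 0 < momentFunctional S w hmom (P * P) := by
  change 0 < ∫ x in S, (P * P).eval x * w x
  rw [setIntegral_pos_iff_support_of_nonneg_ae _ (integrableOn_eval_mul hmom _)]
  · refine lt_of_lt_of_le ?_ (measure_mono (μ := volume) (s := S \ P.rootSet ℝ) ?_)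
    · rw [measure_sdiff_null ((P.rootSet_finite ℝ).measure_zero _)]
      exact hS.measure_pos _ hne
    · rintro t ⟨htS, ht⟩
      have ht' : P.eval t ≠ 0 := fun h0 => ht (by simp [mem_rootSet, hP, h0])
      exact ⟨by simp [ht', (hw t htS).ne'], htS⟩
  · filter_upwards [ae_restrict_mem hS.measurableSet] with t ht
    simp only [eval_mul, Pi.zero_apply]
    exact mul_nonneg (mul_self_nonneg _) (hw t ht).le

/-- **Corollary 2.2 (iii) (non co-prime case).** Under the connection formula
`A_n·c(x)·g_{n−2}(x) = a_{2k−2}(x)·p_n(x) − (x − B_n)·p_{n−1}(x)` with `k ∈ {0,1,2}`,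
if `p_n` has `n` simple real zeros `x_1 < ⋯ < x_n` in `(a,b)`, `g_{n−2}` has `n−2`
simple real zeros in `(a,b)`, and `g_{n−2}` and `p_n` have a common zero, then
(a) the common zero is unique, equals `B_n`, and is neither `x_1` nor `x_n`;
(b) the `n−2` zeros of `g_{n−2}` interlace with the `n−1` non-common zeros of `p_n`;
(c) `x_1 < B_n < x_n`. -/
theorem interlacing_common_zero_case
    (a b : EReal) (hab : a < b)
    (S : Set ℝ) (hS : S = {x : ℝ | a < (x : EReal) ∧ (x : EReal) < b})
    (w : ℝ → ℝ) (hw : ∀ x ∈ S, 0 < w x)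
    (hmom : ∀ j : ℕ, IntegrableOn (fun x => x ^ j * w x) S)
    (p : ℕ → Polynomial ℝ)
    (hpmonic : ∀ j, (p j).Monic) (hpdeg : ∀ j, (p j).natDegree = j)
    (hporth : ∀ i j, i ≠ j → ∫ x in S, (p i).eval x * (p j).eval x * w x = 0)
    (k : ℕ) (hk : k ≤ 2)
    (c : Polynomial ℝ) (hcdeg : c.degree = ((2 * k : ℕ) : WithBot ℕ))
    (hcw : ∀ x ∈ S, 0 < c.eval x * w x)
    (hcwmom : ∀ j : ℕ, IntegrableOn (fun x => x ^ j * (c.eval x * w x)) S)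
    (g : ℕ → Polynomial ℝ)
    (hgmonic : ∀ j, (g j).Monic) (hgdeg : ∀ j, (g j).natDegree = j)
    (hgorth : ∀ i j, i ≠ j →
      ∫ x in S, (g i).eval x * (g j).eval x * (c.eval x * w x) = 0)
    (n : ℕ) (hn : 2 ≤ n)
    (A B : ℝ) (q : Polynomial ℝ)
    (hq0 : k = 0 → q.natDegree = 0)
    (hq1 : 1 ≤ k → q.degree = ((2 * k - 2 : ℕ) : WithBot ℕ))
    (hrec : ∀ x ∈ S, A * c.eval x * (g (n - 2)).eval x =
      q.eval x * (p n).eval x - (x - B) * (p (n - 1)).eval x)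
    (x : Fin n → ℝ) (hxmono : StrictMono x) (hxS : ∀ i, x i ∈ S)
    (hxz : ∀ i, (p n).eval (x i) = 0)
    (y : Fin (n - 2) → ℝ) (hymono : StrictMono y) (hyS : ∀ i, y i ∈ S)
    (hyz : ∀ i, (g (n - 2)).eval (y i) = 0)
    (hcommon : ∃ z : ℝ, (p n).eval z = 0 ∧ (g (n - 2)).eval z = 0) :
    -- (a) the common zero is unique and equal to `B`, and it is an interior zero
    ((p n).eval B = 0 ∧ (g (n - 2)).eval B = 0) ∧
    (∀ z : ℝ, (p n).eval z = 0 → (g (n - 2)).eval z = 0 → z = B) ∧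
    B ≠ x ⟨0, by omega⟩ ∧ B ≠ x ⟨n - 1, by omega⟩ ∧
    -- (b) the `n−2` zeros of `g_{n−2}` interlace with the `n−1` non-common zeros of `p_n`
    (∃ x' : Fin (n - 1) → ℝ, StrictMono x' ∧
      (∀ j, ∃ i, x' j = x i) ∧ (∀ j, x' j ≠ B) ∧
      (∀ i, x i ≠ B → ∃ j, x' j = x i) ∧
      (∀ j : Fin (n - 2),
        x' ⟨j.1, by have := j.isLt; omega⟩ < y j ∧
        y j < x' ⟨j.1 + 1, by have := j.isLt; omega⟩)) ∧
    -- (c) `B` bounds the extreme zeros of `p_n`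
    x ⟨0, by omega⟩ < B ∧ B < x ⟨n - 1, by omega⟩ := by
  obtain ⟨N, rfl⟩ : ∃ N, n = N + 2 := ⟨n - 2, by omega⟩
  change Fin N → ℝ at y
  change ∀ x ∈ S, A * c.eval x * (g N).eval x =
    q.eval x * (p (N + 2)).eval x - (x - B) * (p (N + 1)).eval x at hrec
  change ∀ i, (g N).eval (y i) = 0 at hyz
  change ∃ z : ℝ, (p (N + 2)).eval z = 0 ∧ (g N).eval z = 0 at hcommon
  have hopen : IsOpen S := by
    rw [hS]
    exact (isOpen_Ioo (a := a) (b := b)).preimage continuous_coe_real_ereal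
  have hne : S.Nonempty := ⟨_, hxS 0⟩
  have hc : ∀ t ∈ S, 0 < c.eval t := fun t ht => (pos_iff_pos_of_mul_pos (hcw t ht)).2 (hw t ht)
  have halt : ∀ i : Fin (N + 1),
      (p (N + 1)).eval (x i.castSucc) * (p (N + 1)).eval (x i.succ) < 0 :=
    eval_consecutive_zeros_mul_neg (momentFunctional S w hmom)
      (fun _ hP => momentFunctional_mul_self_pos hopen hne hw hmom hP) p hpmonic hpdeg
      (fun i j hij => by simpa [momentFunctional] using hporth i j hij) (N + 1) x hxmono hxz
  have hR : ∀ i, (p (N + 1)).eval (x i) ≠ 0 := by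
    intro i
    induction i using Fin.lastCases with
    | last => exact right_ne_zero_of_mul (halt (Fin.last N)).ne
    | cast i => exact left_ne_zero_of_mul (halt i).ne
  have hrecx : ∀ i, A * c.eval (x i) * (g N).eval (x i) =
      -((x i - B) * (p (N + 1)).eval (x i)) := by
    intro i
    rw [hrec _ (hxS i), hxz]; ring
  have hA : A ≠ 0 := by
    rintro rfl
    have hB : ∀ i, x i = B := by
      intro i
      have h := hrecx i
      simp only [zero_mul, zero_eq_neg, mul_eq_zero, hR i, or_false] at h
      linarith
    have h01 : x 0 < x 1 := hxmono (by simp)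
    rw [hB, hB] at h01
    exact lt_irrefl _ h01
  have huniq : ∀ z : ℝ, (p (N + 2)).eval z = 0 → (g N).eval z = 0 → z = B ∧ ∃ i, x i = z := by
    intro z hz hgz
    obtain ⟨i, rfl⟩ :=
      (strictMono_zeros_unique (hpmonic _).ne_zero (hpdeg _) hxmono hxz).1 z hz
    have h := hrecx i
    simp only [hgz, mul_zero, zero_eq_neg, mul_eq_zero, hR i, or_false] at h
    exact ⟨by linarith, i, rfl⟩
  obtain ⟨z, hz, hgz⟩ := hcommon
  obtain ⟨rfl, m, hm⟩ := huniq z hz hgz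
  have hmono' : StrictMono fun j => x (m.succAbove j) :=
    hxmono.comp (Fin.strictMono_succAbove m)
  obtain ⟨hall, hyuniq⟩ := strictMono_zeros_unique (hgmonic N).ne_zero (hgdeg N) hymono hyz
  have hsep : ∀ j : Fin N, ∃ t, (x (m.succAbove j.castSucc) < t ∧ t < x (m.succAbove j.succ)) ∧
      (g N).eval t = 0 := by
    intro j
    rcases succAbove_consecutive hxmono m j with h | ⟨i, h1, h2, h3⟩
    · exact ⟨z, by rwa [hm] at h, hgz⟩
    · rw [h1, h2]
      rw [hm] at h3
      have hlt : x i.castSucc < x i.succ := hxmono Fin.castSucc_lt_succ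
      have hsign : (g N).eval (x i.castSucc) * (g N).eval (x i.succ) < 0 := by
        have e : A ^ 2 * c.eval (x i.castSucc) * c.eval (x i.succ) *
            ((g N).eval (x i.castSucc) * (g N).eval (x i.succ)) =
            ((x i.castSucc - z) * (x i.succ - z)) *
              ((p (N + 1)).eval (x i.castSucc) * (p (N + 1)).eval (x i.succ)) := by
          have e1 := hrecx i.castSucc
          have e2 := hrecx i.succ
          calc _ = (A * c.eval (x i.castSucc) * (g N).eval (x i.castSucc)) *
                (A * c.eval (x i.succ) * (g N).eval (x i.succ)) := by ring
            _ = _ := by rw [e1, e2]; ring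
        have hneg := mul_neg_of_pos_of_neg h3 (halt i)
        rw [← e] at hneg
        have hc1 := hc _ (hxS i.castSucc)
        have hc2 := hc _ (hxS i.succ)
        exact (pos_iff_neg_of_mul_neg hneg).1 (by positivity)
      have hcont : ContinuousOn (fun t => (g N).eval t) (Set.Icc (x i.castSucc) (x i.succ)) :=
        (g N).continuous.continuousOn
      rcases mul_neg_iff.1 hsign with ⟨hp, hn'⟩ | ⟨hn', hp⟩
      · obtain ⟨t, ht, ht0⟩ := intermediate_value_Ioo' hlt.le hcont ⟨hn', hp⟩
        exact ⟨t, ht, ht0⟩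
      · obtain ⟨t, ht, ht0⟩ := intermediate_value_Ioo hlt.le hcont ⟨hn', hp⟩
        exact ⟨t, ht, ht0⟩
  choose t ht ht0 using hsep
  have htmono : StrictMono t := by
    intro i j hij
    refine (ht i).2.trans_le (le_trans (hmono'.monotone ?_) (ht j).1.le)
    simpa [Fin.le_def] using hij
  obtain rfl := hyuniq t htmono ht0
  obtain ⟨j, hj⟩ := hall z hgz
  have hlo : x ⟨0, by omega⟩ < z :=
    (hxmono.monotone (Fin.zero_le _)).trans_lt (hj ▸ (ht j).1)
  have hhi : z < x ⟨N + 2 - 1, by omega⟩ :=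
    (hj ▸ (ht j).2).trans_le (hxmono.monotone (Fin.le_last _))
  refine ⟨⟨hz, hgz⟩, fun u hu hgu => (huniq u hu hgu).1, hlo.ne', hhi.ne,
    ⟨fun j => x (m.succAbove j), hmono', fun j => ⟨_, rfl⟩, fun j hj' => ?_, fun i hi => ?_,
      fun j => ht j⟩, hlo, hhi⟩
  · exact Fin.succAbove_ne m j (hxmono.injective (hj'.trans hm.symm))
  · obtain ⟨l, hl⟩ := Fin.exists_succAbove_eq (x := i) (y := m) (fun h => hi (h ▸ hm))
    exact ⟨l, congrArg x hl⟩
end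

section
/- Let λ > 0, 0 < φ < π, n ≥ 2 an integer, and k ∈ {0,1,2}. Define B_n(k) = −(λ)_k (λ)_n cos φ / ((λ)_{n+k−1} sin φ). Then there exist real numbers u and v with P_n^{(λ)}(u;φ) = 0, P_n^{(λ)}(v;φ) = 0 and u < B_n(k) < v; that is, B_n(k) is a strict upper bound for the smallest real zero and a strict lower bound for the largest real zero of the Meixner–Pollaczek polynomial P_n^{(λ)}(x;φ). -/
open scoped BigOperators

/-- Pochhammer symbol `(α)_j = α(α+1)⋯(α+j−1)` in a commutative semiring. -/
noncomputable def poch {R : Type*} [CommSemiring R] (α : R) (j : ℕ) : R :=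
  ∏ i ∈ Finset.range j, (α + i)

/-- The monic Meixner–Pollaczek polynomial
`P_n^{(λ)}(x;φ) = iⁿ (2λ)_n (e^{2iφ}/(e^{2iφ}−1))ⁿ ·
  Σ_{j=0}^{n} [(−n)_j (λ+ix)_j / ((2λ)_j · j!)] (1 − e^{−2iφ})^j`. -/
noncomputable def meixnerPollaczek (lam phi : ℝ) (n : ℕ) (x : ℂ) : ℂ :=
  Complex.I ^ n * poch (2 * (lam : ℂ)) n *
    (Complex.exp (2 * Complex.I * phi) / (Complex.exp (2 * Complex.I * phi) - 1)) ^ n *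
    ∑ j ∈ Finset.range (n + 1),
      poch (-(n : ℂ)) j * poch ((lam : ℂ) + Complex.I * x) j /
          (poch (2 * (lam : ℂ)) j * (j.factorial : ℂ)) *
        (1 - Complex.exp (-(2 * Complex.I * phi))) ^ j

/-- The real sequence defined by the three-term recurrence
`(2λ+j) k_{j+1} = 2 (x s + (j+λ) c) k_j - j k_{j-1}`; for `c = cos φ`, `s = sin φ` it is
the Meixner–Pollaczek sequence up to normalisation. -/
noncomputable def mpRec (lam c s x : ℝ) : ℕ → ℝ
  | 0 => 1
  | 1 => (x * s + lam * c) / lam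
  | j + 2 => (2 * (x * s + ((j : ℝ) + 1 + lam) * c) * mpRec lam c s x (j + 1)
      - ((j : ℝ) + 1) * mpRec lam c s x j) / (2 * lam + j + 1)

section Recurrence

variable {lam c s : ℝ}

lemma mpRec_one (hlam : 0 < lam) (x : ℝ) :
    lam * mpRec lam c s x 1 = x * s + lam * c := by
  rw [mpRec]; field_simp

lemma mpRec_succ_succ (hlam : 0 < lam) (x : ℝ) (j : ℕ) :
    (2 * lam + j + 1) * mpRec lam c s x (j + 2) =
      2 * (x * s + ((j : ℝ) + 1 + lam) * c) * mpRec lam c s x (j + 1)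
        - ((j : ℝ) + 1) * mpRec lam c s x j := by
  have : 2 * lam + j + 1 ≠ 0 := by positivity
  rw [mpRec]; field_simp

lemma continuous_mpRec (lam c s : ℝ) (j : ℕ) : Continuous fun x => mpRec lam c s x j := by
  induction j using Nat.twoStepInduction with
  | zero => simp only [mpRec]; fun_prop
  | one => simp only [mpRec]; fun_prop
  | more j h0 h1 => simp only [mpRec]; fun_prop

lemma mpRec_neg (lam c s x : ℝ) (j : ℕ) :
    mpRec lam (-c) s (-x) j = (-1) ^ j * mpRec lam c s x j := by
  induction j using Nat.twoStepInduction with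
  | zero => simp [mpRec]
  | one => simp only [mpRec]; ring
  | more j h0 h1 => simp only [mpRec, h0, h1]; ring

/-- Far to the right the sequence is positive (and nondecreasing). -/
lemma mpRec_pos_of_large (hlam : 0 < lam) (hc : c < 1) {x : ℝ} {N : ℕ}
    (hx : (N + lam) * (1 - c) ≤ x * s) (j : ℕ) (hj : j ≤ N) :
    0 < mpRec lam c s x j ∧
      (j + 1 ≤ N → mpRec lam c s x j ≤ mpRec lam c s x (j + 1)) := by
  have hc' : 0 < 1 - c := by linarith
  induction j with
  | zero =>
    have h1 := mpRec_one (c := c) (s := s) hlam x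
    have hN : 0 ≤ (N : ℝ) * (1 - c) := by positivity
    refine ⟨by simp [mpRec], fun _ => ?_⟩
    have h0 : mpRec lam c s x 0 = 1 := by simp [mpRec]
    simp only [zero_add]
    rw [h0]
    by_contra! h
    nlinarith
  | succ j ih =>
    obtain ⟨hp, hm⟩ := ih (by omega)
    have hm := hm hj
    refine ⟨by linarith, fun hj2 => ?_⟩
    have h2 := mpRec_succ_succ (c := c) (s := s) hlam x j
    have hjN : (j : ℝ) + 1 ≤ N := by exact_mod_cast hj
    have hxs : (j : ℝ) + 1 + lam ≤ x * s + ((j : ℝ) + 1 + lam) * c := by nlinarith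
    have hp1 : 0 < mpRec lam c s x (j + 1) := by linarith
    have h3 := mul_le_mul_of_nonneg_right hxs hp1.le
    have hj0 : (0 : ℝ) ≤ (j : ℝ) + 1 := by positivity
    have h4 := mul_le_mul_of_nonneg_left hm hj0
    have hpos : 0 < 2 * lam + j + 1 := by positivity
    refine le_of_mul_le_mul_left ?_ hpos
    linarith

lemma exists_forall_mpRec_pos (hlam : 0 < lam) (hc : c < 1) (hs : 0 < s) (j : ℕ) :
    ∃ X : ℝ, ∀ x, X ≤ x → 0 < mpRec lam c s x j := by
  refine ⟨(j + lam) * (1 - c) / s, fun x hx => ?_⟩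
  exact (mpRec_pos_of_large hlam hc ((div_le_iff₀ hs).1 hx) j le_rfl).1

lemma mpRec_nonneg_of_forall_gt {j : ℕ} {x₀ : ℝ}
    (h : ∀ x, x₀ < x → 0 < mpRec lam c s x j) : 0 ≤ mpRec lam c s x₀ j := by
  have ht : Filter.Tendsto (fun x => mpRec lam c s x j) (nhdsWithin x₀ (Set.Ioi x₀))
      (nhds (mpRec lam c s x₀ j)) :=
    (continuous_mpRec lam c s j).continuousWithinAt
  exact ge_of_tendsto ht (Filter.eventually_of_mem self_mem_nhdsWithin fun x hx => (h x hx).le)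

/-- One-sided Sturm interlacing: to the right of the largest zero of one member of the
sequence, the preceding member is positive. -/
lemma mpRec_pos_of_succ_pos (hlam : 0 < lam) (hc : c < 1) (hs : 0 < s) (m : ℕ) :
    ∀ x₀ : ℝ, (∀ x, x₀ < x → 0 < mpRec lam c s x (m + 1)) →
      ∀ x, x₀ ≤ x → 0 < mpRec lam c s x m := by
  induction m with
  | zero => intro x₀ _ x _; simp [mpRec]
  | succ m ih =>
    intro x₀ h x hx
    by_contra! hneg
    obtain ⟨X, hX⟩ := exists_forall_mpRec_pos hlam hc hs (m + 1)
    set S : Set ℝ := {y | x₀ ≤ y} ∩ {y | mpRec lam c s y (m + 1) ≤ 0}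
    have hclosed : IsClosed S :=
      (isClosed_le continuous_const continuous_id).inter
        (isClosed_le (continuous_mpRec lam c s (m + 1)) continuous_const)
    have hne : S.Nonempty := ⟨x, hx, hneg⟩
    have hbdd : BddAbove S := by
      refine ⟨X, fun y hy => ?_⟩
      by_contra! hlt
      exact absurd (hX y hlt.le) (not_lt.2 hy.2)
    obtain ⟨hz₀, hz⟩ := hclosed.csSup_mem hne hbdd
    set z := sSup S
    have hgt : ∀ y, z < y → 0 < mpRec lam c s y (m + 1) := by
      intro y hy
      by_contra! hle
      exact absurd (le_csSup hbdd ⟨le_trans hz₀ hy.le, hle⟩) (not_le.2 hy)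
    have hzero : mpRec lam c s z (m + 1) = 0 := le_antisymm hz (mpRec_nonneg_of_forall_gt hgt)
    have hprev : 0 < mpRec lam c s z m := ih z hgt z le_rfl
    have hnext : 0 ≤ mpRec lam c s z (m + 2) :=
      mpRec_nonneg_of_forall_gt fun y hy => h y (lt_of_le_of_lt hz₀ hy)
    have hrec := mpRec_succ_succ (c := c) (s := s) hlam z m
    rw [hzero] at hrec
    have h1 : 0 ≤ (2 * lam + m + 1) * mpRec lam c s z (m + 2) := by positivity
    have h2 : 0 < ((m : ℝ) + 1) * mpRec lam c s z m := by positivity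
    linarith

/-- If the `n`-th member has no zero to the right of `B`, the earlier members are positive
at `B` and the `n`-th one is nonnegative there. -/
lemma mpRec_pos_of_no_zero (hlam : 0 < lam) (hc : c < 1) (hs : 0 < s) {n : ℕ} {B : ℝ}
    (h : ∀ x, B < x → mpRec lam c s x n ≠ 0) :
    (∀ j < n, 0 < mpRec lam c s B j) ∧ 0 ≤ mpRec lam c s B n := by
  have hpos : ∀ x, B < x → 0 < mpRec lam c s x n := by
    intro x hx
    by_contra! hle
    obtain ⟨X, hX⟩ := exists_forall_mpRec_pos hlam hc hs n
    obtain ⟨y, hy, hy0⟩ := intermediate_value_Icc (le_max_left x X)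
      (continuous_mpRec lam c s n).continuousOn ⟨hle, (hX _ (le_max_right x X)).le⟩
    exact h y (lt_of_lt_of_le hx hy.1) hy0
  refine ⟨fun j hj => ?_, mpRec_nonneg_of_forall_gt hpos⟩
  have key : ∀ d i, i + (d + 1) = n → ∀ x, B ≤ x → 0 < mpRec lam c s x i := by
    intro d
    induction d with
    | zero =>
      rintro i rfl
      exact mpRec_pos_of_succ_pos hlam hc hs i B hpos
    | succ d ih =>
      intro i hi
      exact mpRec_pos_of_succ_pos hlam hc hs i B
        fun x hx => ih (i + 1) (by omega) x hx.le
  exact key (n - j - 1) j (by omega) B le_rfl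

/-- Upper bounds for the ratios of consecutive members at the point
`B = -λ(λ+1)c / ((λ+n)s)`. -/
lemma mpRec_ratio_bound (hlam : 0 < lam) (hc0 : 0 < c) (hc : c < 1) {n : ℕ} (hn : 2 ≤ n)
    {B : ℝ} (hB : (lam + n) * (B * s) = -(lam * (lam + 1) * c))
    (hpos : ∀ j < n, 0 < mpRec lam c s B j) (m : ℕ) (hm : m + 1 ≤ n) :
    (n + 2 * lam) * (n - m) * mpRec lam c s B (m + 1) <
      (n + lam) * (n - m - 1) * mpRec lam c s B m := by
  have hn' : (2 : ℝ) ≤ n := by exact_mod_cast hn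
  have hL : 0 < lam + n := by positivity
  induction m with
  | zero =>
    have h1 := mpRec_one (c := c) (s := s) hlam B
    have h0 : mpRec lam c s B 0 = 1 := by simp [mpRec]
    have hk : (lam + n) * mpRec lam c s B 1 = c * (n - 1) := by
      refine mul_left_cancel₀ hlam.ne' ?_
      linear_combination (lam + n) * h1 + hB
    simp only [zero_add, Nat.cast_zero, sub_zero, h0, mul_one]
    refine lt_of_mul_lt_mul_left ?_ hL.le
    have e : (lam + n) * ((n + 2 * lam) * n * mpRec lam c s B 1) =
        (n + 2 * lam) * n * (c * (n - 1)) := by linear_combination (n + 2 * lam) * n * hk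
    rw [e]
    have hn1 : (0 : ℝ) < n - 1 := by linarith
    have h2 : (n + 2 * lam) * n * c < (lam + n) * (n + lam) := by
      have : (0 : ℝ) < (n + 2 * lam) * n := by positivity
      nlinarith
    nlinarith [mul_lt_mul_of_pos_right h2 hn1]
  | succ m ih =>
    have ih := ih (by omega)
    have hrec := mpRec_succ_succ (c := c) (s := s) hlam B m
    have hk1 : 0 < mpRec lam c s B (m + 1) := hpos _ (by omega)
    set a := mpRec lam c s B m
    set b := mpRec lam c s B (m + 1)
    set d := mpRec lam c s B (m + 2)
    have hmn : (m : ℝ) + 2 ≤ n := by exact_mod_cast hm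
    have hm0 : (0 : ℝ) ≤ m := m.cast_nonneg
    push_cast
    have hu : 0 < (n : ℝ) - m - 1 := by linarith
    have hw : 0 < 2 * lam + m + 1 := by positivity
    have hcoef : 0 < (lam + n) * ((m : ℝ) + 1 + lam) - lam * (lam + 1) := by nlinarith
    have hrec' : (lam + n) * ((2 * lam + m + 1) * d) =
        2 * c * ((lam + n) * ((m : ℝ) + 1 + lam) - lam * (lam + 1)) * b
          - (lam + n) * ((m + 1) * a) := by
      linear_combination (lam + n) * hrec + 2 * b * hB
    have hcb : 2 * c * ((lam + n) * ((m : ℝ) + 1 + lam) - lam * (lam + 1)) * b <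
        2 * ((lam + n) * ((m : ℝ) + 1 + lam) - lam * (lam + 1)) * b := by
      have := mul_pos hcoef hk1
      nlinarith
    have hd : (lam + n) * (n - m - 1) * ((2 * lam + m + 1) * d) <
        (2 * lam + m + 1) * (n * (n - m - 2)) * b := by
      have h1 := mul_lt_mul_of_pos_right hcb hu
      have h2 := mul_lt_mul_of_pos_left ih (by positivity : (0 : ℝ) < m + 1)
      linear_combination (n - m - 1) * hrec' + h1 + h2
    have hd2 : (lam + n) * ((n - m - 1) * d) < n * (n - m - 2) * b := by
      refine lt_of_mul_lt_mul_left ?_ hw.le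
      linarith
    have h3 : (lam + n) * ((n + 2 * lam) * ((n - m - 1) * d)) <
        (lam + n) * ((n + lam) * ((n - m - 2) * b)) := by
      have h4 := mul_lt_mul_of_pos_left hd2 (by positivity : 0 < (n : ℝ) + 2 * lam)
      have h5 : 0 ≤ lam ^ 2 * ((n - m - 2) * b) :=
        mul_nonneg (sq_nonneg _) (mul_nonneg (by linarith) hk1.le)
      linarith
    have h6 := lt_of_mul_lt_mul_left h3 hL.le
    linarith

lemma exists_mpRec_zero_gt (hlam : 0 < lam) (hc : c < 1) (hs : 0 < s) {n : ℕ} (hn : 2 ≤ n)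
    {mu B : ℝ} (hB : B * s = -(mu * c))
    (hmu : mu = lam + n - 1 ∨ mu = lam ∨ (lam + n) * mu = lam * (lam + 1)) :
    ∃ x, B < x ∧ mpRec lam c s x n = 0 := by
  by_contra! h
  obtain ⟨hpos, hnn⟩ := mpRec_pos_of_no_zero hlam hc hs h
  have hn' : (2 : ℝ) ≤ n := by exact_mod_cast hn
  have h1 := mpRec_one (c := c) (s := s) hlam B
  have hp1 : 0 < lam * mpRec lam c s B 1 := mul_pos hlam (hpos 1 (by omega))
  rcases hmu with rfl | rfl | hmu
  · obtain ⟨m, rfl⟩ := Nat.exists_eq_add_of_le' hn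
    have hrec := mpRec_succ_succ (c := c) (s := s) hlam B m
    have hp : 0 < ((m : ℝ) + 1) * mpRec lam c s B m := mul_pos (by positivity) (hpos m (by omega))
    have hq : 0 ≤ (2 * lam + m + 1) * mpRec lam c s B (m + 2) := mul_nonneg (by positivity) hnn
    push_cast at hB
    have e : B * s + ((m : ℝ) + 1 + lam) * c = 0 := by linear_combination hB
    rw [e] at hrec
    linarith
  · linarith
  · rcases le_or_gt c 0 with hc0 | hc0
    · have hlt : mu ≤ lam := by
        refine le_of_mul_le_mul_left ?_ (by positivity : 0 < lam + n)
        nlinarith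
      nlinarith
    · obtain ⟨m, rfl⟩ := Nat.exists_eq_add_of_le' (le_trans one_le_two hn)
      have hr := mpRec_ratio_bound hlam hc0 hc hn
        (by linear_combination (lam + ((m + 1 : ℕ) : ℝ)) * hB - c * hmu) hpos m le_rfl
      push_cast at hr
      nlinarith

end Recurrence

lemma poch_succ {R : Type*} [CommSemiring R] (a : R) (j : ℕ) :
    poch a (j + 1) = poch a j * (a + j) := by
  rw [poch, poch, Finset.prod_range_succ]

lemma poch_neg_natCast_div_factorial (n j : ℕ) :
    poch (-(n : ℂ)) j / (j.factorial : ℂ) = (-1) ^ j * (n.choose j : ℂ) := by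
  induction j with
  | zero => simp [poch]
  | succ j ih =>
    have hj : (j.factorial : ℂ) ≠ 0 := by exact_mod_cast j.factorial_ne_zero
    have hch : ((n.choose (j + 1) : ℕ) : ℂ) * (j + 1) = n.choose j * (n - j) := by
      rcases le_or_gt j n with h | h
      · have := Nat.choose_succ_right_eq n j
        rw [← Nat.cast_sub h]
        exact_mod_cast this
      · simp [Nat.choose_eq_zero_of_lt h, Nat.choose_eq_zero_of_lt (h.trans (Nat.lt_succ_self j))]
    rw [div_eq_iff hj] at ih
    have hj1 : (j : ℂ) + 1 ≠ 0 := by exact_mod_cast j.succ_ne_zero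
    rw [poch_succ, ih, Nat.factorial_succ, div_eq_iff (by push_cast; positivity)]
    push_cast
    linear_combination (-1) ^ j * (j.factorial : ℂ) * hch

section Hypergeometric

/-- The terminating sum `₂F₁(-n, b; c; -y)`. -/
noncomputable def binomSum (b c y : ℂ) (n : ℕ) : ℂ :=
  ∑ j ∈ Finset.range (n + 1), (n.choose j : ℂ) * (poch b j / poch c j) * y ^ j

lemma binomSum_eq_sum_range (b c y : ℂ) {n N : ℕ} (h : n + 1 ≤ N) :
    binomSum b c y n =
      ∑ j ∈ Finset.range N, (n.choose j : ℂ) * (poch b j / poch c j) * y ^ j := by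
  refine Finset.sum_subset (Finset.range_mono h) fun j _ hj => ?_
  have : n < j := by simpa using hj
  simp [Nat.choose_eq_zero_of_lt this]

/-- Contiguous relation in the upper parameter `-n`. -/
lemma binomSum_contiguous (b c y : ℂ) (hc : ∀ j : ℕ, c + j ≠ 0) (n : ℕ) :
    (c + n + 1) * binomSum b c y (n + 2) =
      (2 * (n + 1) + c + (b + n + 1) * y) * binomSum b c y (n + 1)
        - (n + 1) * (1 + y) * binomSum b c y n := by
  have hA : ∀ j : ℕ, (c + j) * (poch b (j + 1) / poch c (j + 1)) =
      (b + j) * (poch b j / poch c j) := by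
    intro j
    have hj := hc j
    have hp : poch c j ≠ 0 := Finset.prod_ne_zero_iff.2 fun i _ => hc i
    rw [poch_succ, poch_succ]
    field_simp
  set A : ℕ → ℂ := fun j => poch b j / poch c j
  have e2 := binomSum_eq_sum_range b c y (show n + 2 + 1 ≤ n + 3 + 1 by omega)
  have e1 := binomSum_eq_sum_range b c y (show n + 1 + 1 ≤ n + 3 + 1 by omega)
  have e0 := binomSum_eq_sum_range b c y (show n + 1 ≤ n + 3 + 1 by omega)
  have f1 := binomSum_eq_sum_range b c y (show n + 1 + 1 ≤ n + 3 by omega)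
  have f0 := binomSum_eq_sum_range b c y (show n + 1 ≤ n + 3 by omega)
  rw [Finset.sum_range_succ'] at e2 e1 e0
  have key : ∀ j : ℕ,
      (c + n + 1) * (((n + 2).choose (j + 1) : ℂ) * A (j + 1) * y ^ (j + 1)) =
      (2 * (n + 1) + c) * (((n + 1).choose (j + 1) : ℂ) * A (j + 1) * y ^ (j + 1))
        + (b + n + 1) * y * (((n + 1).choose j : ℂ) * A j * y ^ j)
        - (n + 1) * ((n.choose (j + 1) : ℂ) * A (j + 1) * y ^ (j + 1))
        - (n + 1) * y * ((n.choose j : ℂ) * A j * y ^ j) := by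
    intro j
    have h1 : ((n + 2).choose (j + 1) : ℂ) = (n + 1).choose j + (n + 1).choose (j + 1) := by
      exact_mod_cast Nat.choose_succ_succ (n + 1) j
    have h2 : ((n + 1).choose (j + 1) : ℂ) = n.choose j + n.choose (j + 1) := by
      exact_mod_cast Nat.choose_succ_succ n j
    have h3 : ((n : ℂ) + 1) * n.choose j = (n + 1).choose (j + 1) * (j + 1) := by
      exact_mod_cast Nat.add_one_mul_choose_eq n j
    have h4 : ((n + 1).choose (j + 1) : ℂ) * (j + 1) = (n + 1).choose j * (n + 1 - j) := by
      rcases le_or_gt j (n + 1) with h | h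
      · have := Nat.choose_succ_right_eq (n + 1) j
        have hs : ((n + 1 - j : ℕ) : ℂ) = (n : ℂ) + 1 - j := by
          rw [Nat.cast_sub h]; push_cast; ring
        rw [← hs]
        exact_mod_cast this
      · simp [Nat.choose_eq_zero_of_lt h, Nat.choose_eq_zero_of_lt (h.trans (Nat.lt_succ_self j))]
    have h5 := hA j
    change (c + j) * A (j + 1) = (b + j) * A j at h5
    have h6 : ((n : ℂ) + 1) * n.choose (j + 1) =
        (n + 1) * (n + 1).choose (j + 1) - (n + 1).choose (j + 1) * (j + 1) := by
      rw [← h3, h2]; ring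
    rw [h1, pow_succ]
    linear_combination y ^ j * y * (A (j + 1) * h6 + A j * (h3 + h4)
      + (n + 1).choose j * h5 - A (j + 1) * h4)
  have hsum := Finset.sum_congr (rfl : Finset.range (n + 3) = Finset.range (n + 3))
    fun j _ => key j
  simp only [Finset.sum_sub_distrib, Finset.sum_add_distrib, ← Finset.mul_sum] at hsum
  simp only [Nat.choose_zero_right] at e0 e1 e2
  rw [← f1, ← f0] at hsum
  linear_combination hsum + (c + n + 1) * e2 - (2 * (n + 1) + c) * e1 + (n + 1) * e0

end Hypergeometric

lemma mpRec_eq_binomSum {lam : ℝ} (hlam : 0 < lam) (phi x : ℝ) (n : ℕ) :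
    (mpRec lam (Real.cos phi) (Real.sin phi) x n : ℂ) =
      Complex.exp (Complex.I * phi) ^ n *
        binomSum (lam + Complex.I * x) (2 * lam)
          (Complex.exp (-(2 * Complex.I * phi)) - 1) n := by
  have hl : (lam : ℂ) ≠ 0 := by exact_mod_cast hlam.ne'
  have hc : ∀ j : ℕ, 2 * (lam : ℂ) + j ≠ 0 := by
    intro j
    have : 2 * lam + j ≠ 0 := by positivity
    exact_mod_cast this
  set E := Complex.exp (Complex.I * phi) with hE
  set D := Complex.exp (-(Complex.I * phi)) with hD
  have hED : E * D = 1 := by rw [hE, hD, ← Complex.exp_add]; simp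
  have hDD : Complex.exp (-(2 * Complex.I * phi)) = D * D := by
    rw [hD, ← Complex.exp_add]; ring_nf
  have hE' : E = Complex.cos phi + Complex.sin phi * Complex.I := by
    rw [hE, mul_comm, Complex.exp_mul_I]
  have hD' : D = Complex.cos phi - Complex.sin phi * Complex.I := by
    rw [hD, mul_comm, ← neg_mul, Complex.exp_mul_I]
    simp [sub_eq_add_neg]
  have hCos : 2 * Complex.cos phi = E + D := by rw [hE', hD']; ring
  have hSin : 2 * Complex.sin phi = -(Complex.I * (E - D)) := by
    rw [hE', hD']; linear_combination 2 * Complex.sin phi * Complex.I_sq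
  clear_value E D
  rw [hDD]
  induction n using Nat.twoStepInduction with
  | zero => simp [mpRec, binomSum, poch]
  | one =>
    simp only [mpRec, binomSum, poch, Finset.sum_range_succ, Finset.prod_range_succ,
      Finset.sum_range_zero, Finset.prod_range_zero]
    push_cast
    simp only [Nat.choose_zero_right, Nat.choose_self, Nat.cast_one, pow_zero,
      pow_one, one_mul, mul_one, add_zero, zero_add, div_one]
    field_simp
    linear_combination lam * hCos + x * hSin - (lam + Complex.I * x) * D * hED
  | more n h0 h1 =>
    have hr := congrArg (fun t : ℝ => (t : ℂ))
      (mpRec_succ_succ (c := Real.cos phi) (s := Real.sin phi) hlam x n)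
    have hb := binomSum_contiguous (lam + Complex.I * x) (2 * lam) (D * D - 1) hc n
    push_cast at hr
    have hne : 2 * (lam : ℂ) + n + 1 ≠ 0 := by
      have := hc (n + 1)
      push_cast at this
      rwa [← add_assoc] at this
    refine mul_left_cancel₀ hne ?_
    rw [hr, h0, h1]
    set F1 := binomSum (lam + Complex.I * x) (2 * lam) (D * D - 1) (n + 1)
    set F0 := binomSum (lam + Complex.I * x) (2 * lam) (D * D - 1) n
    linear_combination -E ^ (n + 2) * hb
      + E ^ (n + 1) * F1 * (x * hSin + ((n : ℂ) + 1 + lam) * hCos)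
      - E ^ (n + 1) * F1 * (lam + Complex.I * x + n + 1) * D * hED
      + (n + 1) * E ^ n * F0 * (E * D + 1) * hED

lemma meixnerPollaczek_eq_zero {lam : ℝ} (hlam : 0 < lam) {phi x : ℝ} {n : ℕ}
    (h : mpRec lam (Real.cos phi) (Real.sin phi) x n = 0) :
    meixnerPollaczek lam phi n (x : ℂ) = 0 := by
  have hb := mpRec_eq_binomSum hlam phi x n
  rw [h, Complex.ofReal_zero, eq_comm, mul_eq_zero] at hb
  have hb := hb.resolve_left (pow_ne_zero _ (Complex.exp_ne_zero _))
  rw [meixnerPollaczek]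
  refine mul_eq_zero_of_right _ (Eq.trans (Finset.sum_congr rfl fun j _ => ?_) hb)
  have hj := poch_neg_natCast_div_factorial n j
  rw [← neg_sub (1 : ℂ) (Complex.exp _), neg_pow (1 - Complex.exp _)]
  linear_combination (poch ((lam : ℂ) + Complex.I * x) j / poch (2 * (lam : ℂ)) j
    * (1 - Complex.exp (-(2 * Complex.I * phi))) ^ j) * hj

/-- **Inner bounds for the extreme zeros of Meixner–Pollaczek polynomials:**
for `λ > 0`, `0 < φ < π`, `n ≥ 2` and `k ∈ {0,1,2}`, the point
`B_n(k) = −(λ)_k (λ)_n cos φ / ((λ)_{n+k−1} sin φ)` lies strictly between the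
smallest and the largest real zero of `P_n^{(λ)}(x;φ)`. -/
theorem meixnerPollaczek_inner_bounds (lam : ℝ) (hlam : 0 < lam)
    (phi : ℝ) (hphi1 : 0 < phi) (hphi2 : phi < Real.pi)
    (n : ℕ) (hn : 2 ≤ n) (k : ℕ) (hk : k ≤ 2) :
    ∃ u v : ℝ,
      meixnerPollaczek lam phi n (u : ℂ) = 0 ∧
      meixnerPollaczek lam phi n (v : ℂ) = 0 ∧
      u < -(poch lam k * poch lam n * Real.cos phi) /
            (poch lam (n + k - 1) * Real.sin phi) ∧
      -(poch lam k * poch lam n * Real.cos phi) /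
            (poch lam (n + k - 1) * Real.sin phi) < v := by
  have hs : 0 < Real.sin phi := Real.sin_pos_of_pos_of_lt_pi hphi1 hphi2
  have hsq := Real.sin_sq_add_cos_sq phi
  have hc1 : Real.cos phi < 1 := by nlinarith
  have hc2 : -Real.cos phi < 1 := by nlinarith
  have hp : ∀ j, 0 < poch lam j := fun j => Finset.prod_pos fun i _ => by positivity
  set mu := poch lam k * poch lam n / poch lam (n + k - 1) with hmudef
  have hmu : mu = lam + n - 1 ∨ mu = lam ∨ (lam + n) * mu = lam * (lam + 1) := by
    obtain ⟨m, rfl⟩ := Nat.exists_eq_add_of_le' hn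
    have hm := (hp (m + 1)).ne'
    have hm2 := (hp (m + 2)).ne'
    interval_cases k
    · left
      rw [hmudef, show m + 2 + 0 - 1 = m + 1 by omega, div_eq_iff hm, poch_succ lam (m + 1)]
      simp only [poch, Finset.prod_range_zero]
      push_cast
      ring
    · right; left
      rw [hmudef, show m + 2 + 1 - 1 = m + 2 by omega, div_eq_iff hm2]
      simp [poch]
    · right; right
      have h3 : lam + ((m + 2 : ℕ) : ℝ) ≠ 0 := by positivity
      rw [hmudef, show m + 2 + 2 - 1 = m + 2 + 1 by omega, poch_succ lam (m + 2)]
      field_simp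
      simp [poch, Finset.prod_range_succ]
  set B := -(poch lam k * poch lam n * Real.cos phi) / (poch lam (n + k - 1) * Real.sin phi)
    with hBdef
  have hB : B * Real.sin phi = -(mu * Real.cos phi) := by
    have := (hp (n + k - 1)).ne'
    rw [hBdef, hmudef]
    field_simp
  obtain ⟨v, hv, hv0⟩ := exists_mpRec_zero_gt hlam hc1 hs hn hB hmu
  obtain ⟨w, hw, hw0⟩ := exists_mpRec_zero_gt (B := -B) hlam hc2 hs hn
    (by linear_combination -hB) hmu
  have hw0' : mpRec lam (Real.cos phi) (Real.sin phi) (-w) n = 0 := by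
    have := mpRec_neg lam (-Real.cos phi) (Real.sin phi) w n
    rwa [neg_neg, hw0, mul_zero] at this
  exact ⟨-w, v, meixnerPollaczek_eq_zero hlam hw0', meixnerPollaczek_eq_zero hlam hv0,
    by linarith, hv⟩
end
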